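/- arXiv:2502.02058 — 2 statements merged into one kernel-verified Lean document; each statement's English description precedes it below -/
import Mathlib

section
/- Let f be a Schwartz symmetric m-tensor field on ℝⁿ, ω₁ a fixed vector, and k ≥ 1. Set g(x) = ⟨x, ω₁⟩^k f(x). Then for every p ≥ k, δ^p g = Σ_{i=0}^{k-1} C(k,i) · p(p-1)···(p+1-(k-i)) · ⟨x, ω₁⟩^i ⟨ω₁^{⊙(k-i)}, δ^{p-(k-i)} f⟩ + ⟨x, ω₁⟩^k δ^p f, where ⟨ω₁^{⊙j}, h⟩ denotes contraction of the tensor field h with ω₁ in its last j indices. -/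
open MeasureTheory
open scoped RealInnerProductSpace
noncomputable section

abbrev E (n : ℕ) := EuclideanSpace ℝ (Fin n)

/-- Tensor field of order `m` on ℝⁿ, given by its components. -/
abbrev TF (n m : ℕ) := E n → (Fin m → Fin n) → ℝ

/-- Partial derivative in the `i`-th coordinate direction. -/
def pd {n : ℕ} (i : Fin n) (g : E n → ℝ) (x : E n) : ℝ :=
  fderiv ℝ g x (EuclideanSpace.single i 1)

/-- All components of the tensor field are Schwartz functions. -/
def IsSchwartzTF {n m : ℕ} (f : TF n m) : Prop :=
  ∀ idx, ∃ g : SchwartzMap (E n) ℝ, (fun x => f x idx) = ⇑g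

/-- The tensor field is symmetric. -/
def IsSymTF {n m : ℕ} (f : TF n m) : Prop :=
  ∀ (x : E n) (σ : Equiv.Perm (Fin m)) (idx : Fin m → Fin n), f x (idx ∘ σ) = f x idx

/-- Divergence δ of a tensor field (contraction of the derivative in the last index). -/
def div' {n m : ℕ} : TF n m → TF n (m - 1) :=
  match m with
  | 0 => fun _ => fun _ _ => 0
  | _ + 1 => fun u x idx => ∑ i : Fin n, pd i (fun y => u y (Fin.snoc idx i)) x

/-- Iterated divergence δ^k. -/
def divIter {n m : ℕ} : (k : ℕ) → TF n m → TF n (m - k)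
  | 0, u => u
  | k + 1, u => div' (divIter k u)

/-- Symmetrization of an `m`-tensor (average over permutations of the indices). -/
def symz {n m : ℕ} (T : (Fin m → Fin n) → ℝ) : (Fin m → Fin n) → ℝ :=
  fun idx => (m.factorial : ℝ)⁻¹ * ∑ σ : Equiv.Perm (Fin m), T (idx ∘ σ)

/-- Symmetrized derivative (inner differentiation) d. -/
def dsym {n m : ℕ} (v : TF n m) : TF n (m + 1) :=
  fun x => symz (fun idx => pd (idx (Fin.last m)) (fun y => v y (idx ∘ Fin.castSucc)) x)

/-- Iterated symmetrized derivative d^k. -/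
def dIter {n m : ℕ} : (k : ℕ) → TF n m → TF n (m + k)
  | 0, v => v
  | k + 1, v => dsym (dIter k v)

/-- Componentwise Laplacian. -/
def lap {n m : ℕ} (u : TF n m) : TF n m :=
  fun x idx => ∑ i : Fin n, pd i (fun y => pd i (fun z => u z idx) y) x

/-- Full contraction of an `m`-tensor field with a family of `m` vectors
(equivalently, with the symmetric product of those vectors when the field is symmetric). -/
def contr {n m : ℕ} (f : TF n m) (v : Fin m → E n) (x : E n) : ℝ :=
  ∑ idx : Fin m → Fin n, f x idx * ∏ j, v j (idx j)

/-- Contraction with a vector `w` in the last index. -/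
def jv {n m : ℕ} (w : E n) : TF n m → TF n (m - 1) :=
  match m with
  | 0 => fun _ => fun _ _ => 0
  | _ + 1 => fun u x idx => ∑ i : Fin n, w i * u x (Fin.snoc idx i)

/-- Iterated contraction with `w` in the last `k` indices. -/
def jvIter {n m : ℕ} (w : E n) : (k : ℕ) → TF n m → TF n (m - k)
  | 0, u => u
  | k + 1, u => jv w (jvIter w k u)

/-- Integral of a scalar function over the hyperplane `{x : ⟪x, ω⟫ = p}`. -/
def hypInt {n : ℕ} (h : E n → ℝ) (ω : E n) (p : ℝ) : ℝ :=
  ∫ y : ((ℝ ∙ ω)ᗮ : Submodule ℝ (E n)), h (p • ω + (y : E n))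

/-- The transversal Radon transform 𝒯^m of a symmetric m-tensor field. -/
def TRT {n m : ℕ} (g : TF n m) (ω : E n) (p : ℝ) : ℝ :=
  hypInt (contr g (fun _ => ω)) ω p

/-! ### List-indexed tensor fields -/

/-- List-indexed extension of a tensor field (zero on lists of the wrong length). -/
def lext {n m : ℕ} (u : TF n m) (x : E n) (l : List (Fin n)) : ℝ :=
  if h : l.length = m then u x (fun j => l[(j : ℕ)]'(by have := j.isLt; omega)) else 0

/-- Divergence on list-indexed fields. -/
def lD {n : ℕ} (F : E n → List (Fin n) → ℝ) : E n → List (Fin n) → ℝ :=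
  fun x l => ∑ i : Fin n, pd i (fun y => F y (l ++ [i])) x

/-- Contraction on list-indexed fields. -/
def lJ {n : ℕ} (w : E n) (F : E n → List (Fin n) → ℝ) : E n → List (Fin n) → ℝ :=
  fun x l => ∑ i : Fin n, w i * F x (l ++ [i])

/-- Smooth and symmetric. -/
def LGood {n : ℕ} (F : E n → List (Fin n) → ℝ) : Prop :=
  (∀ l, ContDiff ℝ (⊤ : ℕ∞) (fun x => F x l)) ∧
    ∀ x l₁ a b l₂, F x (l₁ ++ a :: b :: l₂) = F x (l₁ ++ b :: a :: l₂)

/-- Multiplication by a power of the linear function. -/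
def lS {n : ℕ} (w : E n) (k : ℕ) (F : E n → List (Fin n) → ℝ) : E n → List (Fin n) → ℝ :=
  fun x l => ⟪x, w⟫ ^ k * F x l

theorem snoc_eq_append {n m : ℕ} (l : List (Fin n)) (i : Fin n) (h : l.length = m)
    (h' : (l ++ [i]).length = m + 1) :
    (Fin.snoc (fun j : Fin m => l[(j : ℕ)]'(by have := j.isLt; omega)) i : Fin (m + 1) → Fin n)
      = fun j : Fin (m + 1) => (l ++ [i])[(j : ℕ)]'(by have := j.isLt; omega) := by
  funext j
  refine Fin.lastCases ?_ (fun j => ?_) j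
  · simp [← h]
  · have := j.isLt
    simp [List.getElem_append, h]

theorem lext_div {n m : ℕ} (u : TF n m) : lext (div' u) = lD (lext u) := by
  funext x l
  cases m with
  | zero =>
    simp [lext, div', lD, pd]
  | succ m =>
    by_cases h : l.length = m
    · have h' : l.length = m + 1 - 1 := by omega
      have h2 : ∀ i : Fin n, (l ++ [i]).length = m + 1 := by simp [h]
      simp only [lext, lD, dif_pos h', dif_pos (h2 _), div']
      refine Finset.sum_congr rfl fun i _ => ?_
      congr 1
      funext y
      exact congrArg (u y) (snoc_eq_append l i h (h2 i))
    · have h' : ¬ l.length = m + 1 - 1 := by omega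
      have h2 : ∀ i : Fin n, ¬ (l ++ [i]).length = m + 1 := by simp [h]
      simp only [lext, lD, dif_neg h', dif_neg (h2 _), pd]
      simp

theorem lext_jv {n m : ℕ} (w : E n) (u : TF n m) : lext (jv w u) = lJ w (lext u) := by
  funext x l
  cases m with
  | zero =>
    simp [lext, jv, lJ]
  | succ m =>
    by_cases h : l.length = m
    · have h' : l.length = m + 1 - 1 := by omega
      have h2 : ∀ i : Fin n, (l ++ [i]).length = m + 1 := by simp [h]
      simp only [lext, lJ, dif_pos h', dif_pos (h2 _), jv]
      refine Finset.sum_congr rfl fun i _ => ?_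
      congr 1
      exact congrArg (u x) (snoc_eq_append l i h (h2 i))
    · have h' : ¬ l.length = m + 1 - 1 := by omega
      have h2 : ∀ i : Fin n, ¬ (l ++ [i]).length = m + 1 := by simp [h]
      simp only [lext, lJ, dif_neg h', dif_neg (h2 _)]
      simp

theorem lext_divIter {n m : ℕ} (u : TF n m) (p : ℕ) :
    lext (divIter p u) = lD^[p] (lext u) := by
  induction p with
  | zero => rfl
  | succ p ih =>
    rw [Function.iterate_succ_apply', ← ih]
    exact lext_div _

theorem lext_jvIter {n m : ℕ} (w : E n) (u : TF n m) (p : ℕ) :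
    lext (jvIter w p u) = (lJ w)^[p] (lext u) := by
  induction p with
  | zero => rfl
  | succ p ih =>
    rw [Function.iterate_succ_apply', ← ih]
    exact lext_jv _ _

theorem lext_ofFn {n m q : ℕ} (u : TF n m) (x : E n) (idx : Fin q → Fin n) (h : m = q) :
    lext u x (List.ofFn idx) = u x (fun j => idx (Fin.cast h j)) := by
  subst h
  simp [lext]

theorem lext_good {n m : ℕ} (f : TF n m) (hS : IsSchwartzTF f) (hsym : IsSymTF f) :
    LGood (lext f) := by
  refine ⟨fun l => ?_, fun x l₁ a b l₂ => ?_⟩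
  · by_cases h : l.length = m
    · simp only [lext, dif_pos h]
      obtain ⟨g, hg⟩ := hS (fun j => l[(j : ℕ)]'(by have := j.isLt; omega))
      rw [hg]
      exact g.smooth _
    · simp only [lext, dif_neg h]
      exact contDiff_const
  · by_cases h : (l₁ ++ a :: b :: l₂).length = m
    · have h' : (l₁ ++ b :: a :: l₂).length = m := by simpa using h
      simp only [lext, dif_pos h, dif_pos h']
      have hl : l₁.length + (l₂.length + 1 + 1) = m := by simpa using h
      rw [← hsym x (Equiv.swap ⟨l₁.length, by omega⟩ ⟨l₁.length + 1, by omega⟩)]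
      congr 1
      funext j
      simp only [Function.comp, Equiv.swap_apply_def]
      split_ifs with h1 h2
      · subst h1; simp
      · subst h2; simp
      · have h1' : (j : ℕ) ≠ l₁.length := fun e => h1 (Fin.ext e)
        have h2' : (j : ℕ) ≠ l₁.length + 1 := fun e => h2 (Fin.ext e)
        simp only [List.getElem_append]
        split_ifs with h3
        · rfl
        · obtain ⟨c, hc⟩ : ∃ c, (j : ℕ) - l₁.length = c + 2 := ⟨j - l₁.length - 2, by omega⟩
          simp only [hc, List.getElem_cons_succ]
    · have h' : ¬ (l₁ ++ b :: a :: l₂).length = m := by simpa using h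
      simp only [lext, dif_neg h, dif_neg h']

theorem LGood.diff {n : ℕ} {F : E n → List (Fin n) → ℝ} (hF : LGood F) (l : List (Fin n)) :
    Differentiable ℝ (fun x => F x l) := (hF.1 l).differentiable (by simp)

theorem pd_smooth {n : ℕ} (i : Fin n) {g : E n → ℝ} (hg : ContDiff ℝ (⊤ : ℕ∞) g) :
    ContDiff ℝ (⊤ : ℕ∞) (pd i g) := by
  unfold pd
  exact (hg.fderiv_right (m := (⊤ : ℕ∞)) (by simp)).clm_apply contDiff_const

theorem LGood.lD {n : ℕ} {F : E n → List (Fin n) → ℝ} (hF : LGood F) : LGood (lD F) := by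
  refine ⟨fun l => ?_, fun x l₁ a b l₂ => ?_⟩
  · exact ContDiff.sum fun i _ => pd_smooth i (hF.1 _)
  · unfold _root_.lD
    simp only [List.append_assoc, List.cons_append]
    simp only [hF.2 _ l₁ a b]

theorem LGood.lJ {n : ℕ} (w : E n) {F : E n → List (Fin n) → ℝ} (hF : LGood F) :
    LGood (lJ w F) := by
  refine ⟨fun l => ?_, fun x l₁ a b l₂ => ?_⟩
  · exact ContDiff.sum fun i _ => contDiff_const.mul (hF.1 _)
  · unfold _root_.lJ
    simp only [List.append_assoc, List.cons_append]
    simp only [hF.2 _ l₁ a b]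

theorem LGood.lS {n : ℕ} (w : E n) (k : ℕ) {F : E n → List (Fin n) → ℝ} (hF : LGood F) :
    LGood (lS w k F) := by
  refine ⟨fun l => ?_, fun x l₁ a b l₂ => ?_⟩
  · exact ((contDiff_id.inner ℝ contDiff_const).pow k).mul (hF.1 _)
  · unfold _root_.lS
    rw [hF.2]

theorem LGood.add_smul {n : ℕ} {F G : E n → List (Fin n) → ℝ} (c : ℝ)
    (hF : LGood F) (hG : LGood G) : LGood (F + c • G) := by
  refine ⟨fun l => ?_, fun x l₁ a b l₂ => ?_⟩
  · exact (hF.1 l).add (contDiff_const.mul (hG.1 l))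
  · simp [hF.2 x l₁ a b, hG.2 x l₁ a b]

theorem lD_add_smul {n : ℕ} {F G : E n → List (Fin n) → ℝ} (c : ℝ)
    (hF : LGood F) (hG : LGood G) : lD (F + c • G) = lD F + c • lD G := by
  funext x l
  simp only [lD, pd, Pi.add_apply, Pi.smul_apply, smul_eq_mul, Finset.mul_sum,
    ← Finset.sum_add_distrib]
  refine Finset.sum_congr rfl fun i _ => ?_
  have h := ((hF.diff (l ++ [i]) x).hasFDerivAt.add
    ((hG.diff (l ++ [i]) x).hasFDerivAt.const_mul c)).fderiv
  have h2 := congrArg (fun L => L (EuclideanSpace.single i 1)) h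
  refine h2.trans ?_
  simp

theorem lDit_add_smul {n : ℕ} (p : ℕ) : ∀ {F G : E n → List (Fin n) → ℝ} (c : ℝ)
    (_ : LGood F) (_ : LGood G), lD^[p] (F + c • G) = lD^[p] F + c • lD^[p] G := by
  induction p with
  | zero => intros; rfl
  | succ p ih =>
    intro F G c hF hG
    simp only [Function.iterate_succ_apply]
    rw [lD_add_smul c hF hG, ih c hF.lD hG.lD]

theorem lD_lJ {n : ℕ} (w : E n) {F : E n → List (Fin n) → ℝ} (hF : LGood F) :
    lD (lJ w F) = lJ w (lD F) := by
  funext x l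
  simp only [lD, lJ, Finset.mul_sum]
  rw [Finset.sum_comm]
  refine Finset.sum_congr rfl fun i _ => ?_
  have h := (HasFDerivAt.fun_sum (u := Finset.univ) fun (a : Fin n) _ =>
    ((hF.diff (l ++ [i] ++ [a]) x).hasFDerivAt.const_mul (w a))).fderiv
  have h2 := congrArg (fun L => L (EuclideanSpace.single i 1)) h
  simp only [pd]
  refine h2.trans ?_
  simp only [List.append_assoc, List.cons_append, List.nil_append, hF.2 _ l i]
  simp

theorem lDit_lJ {n : ℕ} (w : E n) (p : ℕ) : ∀ {F : E n → List (Fin n) → ℝ} (_ : LGood F),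
    lD^[p] (lJ w F) = lJ w (lD^[p] F) := by
  induction p with
  | zero => intros; rfl
  | succ p ih =>
    intro F hF
    simp only [Function.iterate_succ_apply]
    rw [lD_lJ w hF, ih hF.lD]

theorem lD_lS {n : ℕ} (w : E n) (k : ℕ) {F : E n → List (Fin n) → ℝ} (hF : LGood F) :
    lD (lS w (k + 1) F) = lS w (k + 1) (lD F) + ((k : ℝ) + 1) • lS w k (lJ w F) := by
  funext x l
  simp only [lD, lS, lJ, pd, Pi.add_apply, Pi.smul_apply, smul_eq_mul, Finset.mul_sum,
    ← Finset.sum_add_distrib]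
  refine Finset.sum_congr rfl fun i _ => ?_
  have hin : HasFDerivAt (fun y : E n => ⟪y, w⟫) (innerSL ℝ w) x := by
    have := (innerSL ℝ w).hasFDerivAt (x := x)
    refine this.congr_of_eventuallyEq (Filter.Eventually.of_forall fun y => ?_)
    simp [real_inner_comm]
  have h := ((hin.pow (k + 1)).mul (hF.diff (l ++ [i]) x).hasFDerivAt).fderiv
  have h2 := congrArg (fun L => L (EuclideanSpace.single i 1)) h
  refine h2.trans ?_
  simp [EuclideanSpace.inner_single_right]
  ring

theorem lmain {n : ℕ} (w : E n) (p : ℕ) : ∀ (k : ℕ) {F : E n → List (Fin n) → ℝ}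
    (_ : LGood F) (x : E n) (l : List (Fin n)),
    lD^[p] (lS w k F) x l = ∑ j ∈ Finset.range (k + 1),
      ((k.choose j * p.descFactorial j : ℕ) : ℝ) * ⟪x, w⟫ ^ (k - j) *
        (lJ w)^[j] (lD^[p - j] F) x l := by
  induction p with
  | zero =>
    intro k F hF x l
    rw [Finset.sum_range_succ']
    simp [lS]
  | succ p ih =>
    intro k F hF x l
    cases k with
    | zero =>
      have : lS w 0 F = F := by funext x l; simp [lS]
      simp [this]
    | succ k =>
      rw [Function.iterate_succ_apply, lD_lS w k hF,
        lDit_add_smul p _ (hF.lD.lS w _) ((hF.lJ w).lS w _)]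
      simp only [Pi.add_apply, Pi.smul_apply, smul_eq_mul]
      rw [ih _ hF.lD, ih _ (hF.lJ w), Finset.sum_range_succ', Finset.sum_range_succ' _ (k + 1),
        Finset.mul_sum, add_right_comm, ← Finset.sum_add_distrib]
      congr 1
      · refine Finset.sum_congr rfl fun j _ => ?_
        rw [lDit_lJ w _ hF, ← Function.iterate_succ_apply (lJ w) j,
          ← Function.iterate_succ_apply lD (p - (j + 1))]
        have e1 : p + 1 - (j + 1) = p - j := by omega
        have e2 : k + 1 - (j + 1) = k - j := by omega
        rw [e1, e2]
        have hc : ((k + 1 : ℕ) : ℝ) * (k.choose j : ℝ) = ((k + 1).choose (j + 1) : ℝ) * (j + 1) := by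
          exact_mod_cast Nat.add_one_mul_choose_eq k j
        push_cast at hc
        rcases Nat.lt_or_ge p (j + 1) with hp | hp
        · have h0 : p.descFactorial (j + 1) = 0 := Nat.descFactorial_eq_zero_iff_lt.2 hp
          rw [h0, Nat.succ_descFactorial_succ]
          rcases Nat.lt_or_ge p j with hp' | hp'
          · have h1 : p.descFactorial j = 0 := Nat.descFactorial_eq_zero_iff_lt.2 hp'
            simp [h1]
          · obtain rfl : p = j := by omega
            push_cast
            linear_combination ((p.descFactorial p : ℝ) * ⟪x, w⟫ ^ (k - p) *
              (lJ w)^[p + 1] (lD^[p - p] F) x l) * hc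
        · have e3 : (p - (j + 1)).succ = p - j := by omega
          rw [e3, Nat.succ_descFactorial_succ, Nat.descFactorial_succ]
          obtain ⟨q, rfl⟩ : ∃ q, p = j + q := ⟨p - j, by omega⟩
          have e4 : j + q - j = q := by omega
          rw [e4]
          push_cast
          linear_combination (((j + q).descFactorial j : ℝ) * ⟪x, w⟫ ^ (k - j) *
              (lJ w)^[j + 1] (lD^[q] F) x l) * hc

/-- Iterated divergence of `g = ⟨x, ω₁⟩^k f`:
`δ^p g = ∑_{i=0}^{k-1} C(k,i) p(p-1)⋯(p+1-(k-i)) ⟨x,ω₁⟩^i ⟨ω₁^{⊙(k-i)}, δ^{p-(k-i)} f⟩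
        + ⟨x,ω₁⟩^k δ^p f` for every `p ≥ k ≥ 1`. -/
theorem stmt6 {n m k p : ℕ} (hk : 1 ≤ k) (hkp : k ≤ p)
    (f : TF n m) (hS : IsSchwartzTF f) (hsym : IsSymTF f)
    (w : E n) (x : E n) (idx : Fin (m - p) → Fin n) :
    divIter p (fun y idx' => ⟪y, w⟫ ^ k * f y idx') x idx
      = (∑ i : Fin k,
          ((k.choose (i : ℕ) * p.descFactorial (k - (i : ℕ)) : ℕ) : ℝ) * ⟪x, w⟫ ^ (i : ℕ) *
            jvIter w (k - (i : ℕ)) (divIter (p - (k - (i : ℕ))) f) x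
              (fun j => idx (Fin.cast (by have := i.isLt; omega) j)))
        + ⟪x, w⟫ ^ k * divIter p f x idx := by
  have hG := lext_good f hS hsym
  have hext : lext (fun y idx' => ⟪y, w⟫ ^ k * f y idx') = lS w k (lext f) := by
    funext y l
    by_cases h : l.length = m
    · simp [lext, lS, h]
    · simp [lext, lS, h]
  have hA : ∀ u : TF n m, divIter p u x idx = lD^[p] (lext u) x (List.ofFn idx) := by
    intro u
    rw [← lext_divIter, lext_ofFn _ _ _ rfl]
    rfl
  rw [hA, hA, hext, lmain w p k hG, Finset.sum_range_succ', ← Finset.sum_range_reflect,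
    Finset.sum_range]
  congr 1
  · refine Finset.sum_congr rfl fun i _ => ?_
    have hi := i.isLt
    have e1 : k - 1 - (i : ℕ) + 1 = k - i := by omega
    have e2 : k - (k - (i : ℕ)) = i := by omega
    rw [e1, e2, Nat.choose_symm hi.le, ← lext_divIter, ← lext_jvIter, lext_ofFn]
  · simp

end
end

section
/- Let g be a Schwartz symmetric m-tensor field on ℝⁿ. Then R(δᵐ g)(ω, p) = ∂ᵐ/∂pᵐ [𝒯ᵐ g(ω, p)], where R is the scalar Radon transform and 𝒯ᵐ g(ω, p) = ∫_{H_{ω,p}} ⟨g(x), ω^{⊙m}⟩ dx is the transversal Radon transform. -/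
open MeasureTheory
open scoped RealInnerProductSpace
noncomputable section

open LineDeriv in
/-- Restriction of a Schwartz function to a hyperplane, as a Schwartz function. -/
def hypRestr {n : ℕ} (f : SchwartzMap (E n) ℝ) (ω : E n) (p : ℝ) :
    SchwartzMap ((ℝ ∙ ω)ᗮ : Submodule ℝ (E n)) ℝ :=
  SchwartzMap.compCLMOfAntilipschitz ℝ (K := 1)
    (g := fun y : ((ℝ ∙ ω)ᗮ : Submodule ℝ (E n)) => p • ω + (y : E n))
    ((Function.HasTemperateGrowth.const (p • ω)).add
      ((ℝ ∙ ω)ᗮ.subtypeL).hasTemperateGrowth)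
    (fun x y => by simp [edist_dist, dist_eq_norm]) f

theorem hypRestr_apply {n : ℕ} (f : SchwartzMap (E n) ℝ) (ω : E n) (p : ℝ)
    (y : ((ℝ ∙ ω)ᗮ : Submodule ℝ (E n))) : hypRestr f ω p y = f (p • ω + (y : E n)) := rfl

theorem integrable_hyp {n : ℕ} (f : SchwartzMap (E n) ℝ) (ω : E n) (p : ℝ) :
    Integrable (fun y : ((ℝ ∙ ω)ᗮ : Submodule ℝ (E n)) => f (p • ω + (y : E n))) :=
  (hypRestr f ω p).integrable

theorem norm_le_hyp {n : ℕ} (ω : E n) (p : ℝ) (y : ((ℝ ∙ ω)ᗮ : Submodule ℝ (E n))) :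
    ‖y‖ ≤ ‖p • ω + (y : E n)‖ := by
  have h0 : ⟪ω, (y : E n)⟫ = 0 := Submodule.mem_orthogonal_singleton_iff_inner_right.1 y.2
  have h : ⟪p • ω, (y : E n)⟫ = 0 := by rw [inner_smul_left, h0]; simp
  have h2 := norm_add_sq_eq_norm_sq_add_norm_sq_real h
  have h3 : ‖y‖ = ‖(y : E n)‖ := rfl
  rw [h3]
  refine abs_le_of_sq_le_sq' ?_ (norm_nonneg _) |>.2
  nlinarith [norm_nonneg (p • ω)]

open LineDeriv in
theorem hasDerivAt_hyp {n : ℕ} (f : SchwartzMap (E n) ℝ) (ω : E n) (p : ℝ) :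
    HasDerivAt (fun q => hypInt f ω q) (hypInt (∂_{ω} f : SchwartzMap (E n) ℝ) ω p) p := by
  unfold hypInt
  set k : ℕ := Module.finrank ℝ ((ℝ ∙ ω)ᗮ : Submodule ℝ (E n)) + 1 with hk
  set C : ℝ := 2 ^ k * ((Finset.Iic (k, 0)).sup fun m => SchwartzMap.seminorm ℝ m.1 m.2)
    (∂_{ω} f : SchwartzMap (E n) ℝ) with hC
  have hdec : ∀ x : E n, (1 + ‖x‖) ^ k * ‖(∂_{ω} f : SchwartzMap (E n) ℝ) x‖ ≤ C := fun x => by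
    simpa using SchwartzMap.one_add_le_sup_seminorm_apply (𝕜 := ℝ) (m := (k, 0)) (le_refl k)
      (le_refl 0) (∂_{ω} f : SchwartzMap (E n) ℝ) x
  have hI : Integrable (fun y : ((ℝ ∙ ω)ᗮ : Submodule ℝ (E n)) =>
      C * (1 + ‖y‖) ^ (-(k : ℝ))) :=
    (integrable_one_add_norm (by rw [hk]; push_cast; linarith)).const_mul C
  refine (hasDerivAt_integral_of_dominated_loc_of_deriv_le (s := Set.univ)
    (F' := fun q (y : ((ℝ ∙ ω)ᗮ : Submodule ℝ (E n))) =>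
      (∂_{ω} f : SchwartzMap (E n) ℝ) (q • ω + (y : E n))) Filter.univ_mem
    (Filter.Eventually.of_forall fun q => (integrable_hyp f ω q).aestronglyMeasurable)
    (integrable_hyp f ω p) (integrable_hyp _ ω p).aestronglyMeasurable
    (Filter.Eventually.of_forall fun y q _ => ?_) hI
    (Filter.Eventually.of_forall fun y q _ => ?_)).2
  · have h1 := hdec (q • ω + (y : E n))
    have h2 := norm_le_hyp ω q y
    have hpos : (0 : ℝ) < (1 + ‖y‖) ^ k := by positivity
    rw [Real.rpow_neg (by positivity), Real.rpow_natCast, ← div_eq_mul_inv, le_div_iff₀ hpos,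
      mul_comm]
    refine le_trans ?_ h1
    gcongr
  · rw [SchwartzMap.lineDerivOp_apply_eq_fderiv]
    have h1 : HasDerivAt (fun q : ℝ => q • ω + (y : E n)) ω q := by
      simpa using ((hasDerivAt_id q).smul_const ω).add_const (y : E n)
    exact (f.differentiableAt.hasFDerivAt (x := q • ω + (y : E n))).comp_hasDerivAt q h1

open LineDeriv in
theorem hyp_perp {n : ℕ} (f : SchwartzMap (E n) ℝ) (ω v : E n) (hv : v ∈ (ℝ ∙ ω)ᗮ) (p : ℝ) :
    hypInt (∂_{v} f : SchwartzMap (E n) ℝ) ω p = 0 := by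
  unfold hypInt
  have key : ∀ y : ((ℝ ∙ ω)ᗮ : Submodule ℝ (E n)), fderiv ℝ (hypRestr f ω p) y ⟨v, hv⟩
      = (∂_{v} f : SchwartzMap (E n) ℝ) (p • ω + (y : E n)) := fun y => by
    rw [SchwartzMap.lineDerivOp_apply_eq_fderiv]
    have h1 : HasFDerivAt (fun y : ((ℝ ∙ ω)ᗮ : Submodule ℝ (E n)) => p • ω + (y : E n))
        ((ℝ ∙ ω)ᗮ.subtypeL) y := ((ℝ ∙ ω)ᗮ.subtypeL).hasFDerivAt.const_add _
    have h2 := (f.differentiableAt.hasFDerivAt (x := p • ω + (y : E n))).comp y h1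
    have h3 : fderiv ℝ (hypRestr f ω p) y = _ := h2.fderiv
    rw [h3]; rfl
  have := integral_mul_fderiv_eq_neg_fderiv_mul_of_integrable (𝕜 := ℝ)
    (μ := (volume : Measure ((ℝ ∙ ω)ᗮ : Submodule ℝ (E n))))
    (f := fun _ => (1 : ℝ)) (g := hypRestr f ω p) (v := ⟨v, hv⟩)
    (by simp) (by simp only [key, one_mul]; exact integrable_hyp _ ω p)
    (by simpa using (hypRestr f ω p).integrable) (fun _ _ => by fun_prop)
    (fun _ _ => (hypRestr f ω p).differentiableAt)
  simpa [key] using this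

open LineDeriv in
theorem hyp_pd {n : ℕ} (f : SchwartzMap (E n) ℝ) (ω : E n) (hω : ‖ω‖ = 1) (i : Fin n) (p : ℝ) :
    HasDerivAt (fun q => ω i * hypInt f ω q) (hypInt (pd i f) ω p) p := by
  set e : E n := EuclideanSpace.single i 1 with he
  have hin : ⟪ω, e⟫ = ω i := by
    rw [he, EuclideanSpace.inner_single_right]; simp
  have hv : e - ω i • ω ∈ (ℝ ∙ ω)ᗮ := by
    rw [Submodule.mem_orthogonal_singleton_iff_inner_right, inner_sub_right, inner_smul_right, hin,
      real_inner_self_eq_norm_sq, hω]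
    ring
  have h := (hasDerivAt_hyp f ω p).const_mul (ω i)
  have h2 := hyp_perp f ω _ hv p
  have : hypInt (pd i f) ω p = hypInt (∂_{e - ω i • ω} f : SchwartzMap (E n) ℝ) ω p
      + ω i * hypInt (∂_{ω} f : SchwartzMap (E n) ℝ) ω p := by
    unfold hypInt
    rw [← integral_const_mul, ← integral_add (integrable_hyp _ ω p)
      ((integrable_hyp _ ω p).const_mul _)]
    congr 1; ext y
    simp only [SchwartzMap.lineDerivOp_apply_eq_fderiv, pd, map_sub, map_smul, smul_eq_mul]
    ring
  rw [this, h2, zero_add]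
  exact h

theorem hypInt_contr {n m : ℕ} (g : TF n m) (hS : IsSchwartzTF g) (ω : E n) (p : ℝ) :
    TRT g ω p = ∑ idx : Fin m → Fin n, hypInt (fun x => g x idx) ω p * ∏ j, ω (idx j) := by
  unfold TRT contr hypInt
  rw [integral_finsetSum]
  · simp only [integral_mul_const]
  · intro idx _
    obtain ⟨f, hf⟩ := hS idx
    simp only [fun x => congrFun hf x]
    exact (integrable_hyp f ω p).mul_const _

open LineDeriv in
theorem pd_schwartz {n : ℕ} (f : SchwartzMap (E n) ℝ) (i : Fin n) :
    pd i f = (∂_{(EuclideanSpace.single i 1 : E n)} f : SchwartzMap (E n) ℝ) := by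
  ext x; rw [SchwartzMap.lineDerivOp_apply_eq_fderiv]; rfl

open LineDeriv in
theorem schwartz_div {n m : ℕ} (g : TF n (m + 1)) (hS : IsSchwartzTF g) :
    IsSchwartzTF (m := m) (div' g) := by
  intro idx
  choose f hf using hS
  refine ⟨∑ i, ∂_{(EuclideanSpace.single i 1 : E n)} (f (Fin.snoc idx i)), ?_⟩
  ext x
  rw [SchwartzMap.sum_apply]
  refine Finset.sum_congr rfl fun i _ => ?_
  rw [← pd_schwartz, ← hf]

theorem hasDerivAt_TRT {n m : ℕ} (g : TF n (m + 1)) (hS : IsSchwartzTF g) (ω : E n)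
    (hω : ‖ω‖ = 1) (p : ℝ) :
    HasDerivAt (fun q => TRT g ω q) (TRT (m := m) (div' g) ω p) p := by
  rw [hypInt_contr (m := m) _ (schwartz_div g hS)]
  simp only [hypInt_contr g hS]
  choose f hf using hS
  have hdiv : ∀ idx : Fin m → Fin n, hypInt (fun x => (div' g : TF n m) x idx) ω p
      = ∑ i, hypInt (pd i (f (Fin.snoc idx i))) ω p := fun idx => by
    unfold hypInt
    rw [← integral_finsetSum]
    · congr 1; ext y
      refine Finset.sum_congr rfl fun i _ => ?_
      rw [hf]
    · intro i _
      rw [pd_schwartz]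
      exact integrable_hyp _ ω p
  simp only [hdiv, hf, Finset.sum_mul]
  have hre : ∀ q, ∑ idx : Fin (m + 1) → Fin n, hypInt (f idx) ω q * ∏ j, ω (idx j)
      = ∑ idx : Fin m → Fin n, ∑ i, (ω i * hypInt (f (Fin.snoc idx i)) ω q) * ∏ j, ω (idx j) := by
    intro q
    rw [← (Fin.snocEquiv (fun _ => Fin n)).sum_comp, Fintype.sum_prod_type, Finset.sum_comm]
    refine Finset.sum_congr rfl fun idx _ => Finset.sum_congr rfl fun i _ => ?_
    simp only [Fin.snocEquiv, Equiv.coe_fn_mk, Fin.prod_univ_castSucc, Fin.snoc_castSucc,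
      Fin.snoc_last]
    ring
  simp only [hre]
  exact HasDerivAt.fun_sum fun idx _ => HasDerivAt.fun_sum fun i _ =>
    (hyp_pd _ ω hω i p).mul_const _

theorem div'_heq {n a b : ℕ} (h : a = b) (u : TF n a) (v : TF n b) (huv : HEq u v) :
    HEq (div' u) (div' v) := by
  subst h; rw [eq_of_heq huv]

theorem divIter_heq {n m : ℕ} (k : ℕ) (g : TF n (m + 1)) :
    HEq (divIter (k + 1) g) (divIter (m := m) k (div' g)) := by
  induction k with
  | zero => exact HEq.rfl
  | succ k ih => exact div'_heq (Nat.add_sub_add_right m 1 k) _ _ ih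

theorem apply_heq {n a b : ℕ} (ha : a = 0) (hb : b = 0) (u : TF n a) (v : TF n b) (huv : HEq u v)
    (x : E n) (i : Fin a → Fin n) (j : Fin b → Fin n) : u x i = v x j := by
  subst ha; subst hb; rw [eq_of_heq huv, Subsingleton.elim i j]

theorem stmt7_aux {n : ℕ} (ω : E n) (hω : ‖ω‖ = 1) (m : ℕ) : ∀ (g : TF n m), IsSchwartzTF g →
    ∀ (p : ℝ) (e : Fin (m - m) → Fin n),
    hypInt (fun x => divIter m g x e) ω p = iteratedDeriv m (fun q => TRT g ω q) p := by
  induction m with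
  | zero =>
    intro g hS p e
    rw [iteratedDeriv_zero, hypInt_contr g hS]
    simp only [Fintype.sum_unique, Finset.univ_eq_empty, Finset.prod_empty, mul_one]
    have he : e = (default : Fin 0 → Fin n) :=
      Subsingleton.elim (α := Fin 0 → Fin n) e default
    rw [he]
    rfl
  | succ m ih =>
    intro g hS p e
    have hd : deriv (fun q => TRT g ω q) = fun q => TRT (m := m) (div' g) ω q :=
      funext fun q => (hasDerivAt_TRT g hS ω hω q).deriv
    rw [iteratedDeriv_succ', hd, ← ih (div' g) (schwartz_div g hS) p
      (fun j => Fin.elim0 (Fin.cast (show m - m = 0 by omega) j))]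
    congr 1; ext x
    exact apply_heq (by omega) (by omega) _ _ (divIter_heq m g) x _ _

/-- `R(δ^m g)(ω, p) = ∂^m/∂p^m [𝒯^m g(ω, p)]` for a Schwartz symmetric m-tensor field `g`. -/
theorem stmt7 {n m : ℕ} (g : TF n m) (hS : IsSchwartzTF g) (hsym : IsSymTF g)
    (ω : E n) (hω : ‖ω‖ = 1) (p : ℝ) :
    hypInt (fun x => divIter m g x
        (fun j => Fin.elim0 (Fin.cast (show m - m = 0 by omega) j))) ω p
      = iteratedDeriv m (fun q => TRT g ω q) p := by
  exact stmt7_aux ω hω m g hS p _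

end
end
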